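/- Given t̄ ∈ PC^tt_∞(K_N, Σ_N) and, for each k < ω, a coloring c_k : AR_{k+1}|t̄ → l_k for some l_k ≥ 1, there is an s̄ ≤ t̄ in PC^tt_∞(K_N, Σ_N) such that m^{s_0}_dn = m^{t_0}_dn, c_0 is constant on r_1[0, s̄] ∩ Σ_N(s̄), and for each k ≥ 1 the coloring c_k is constant on r_{k+1}[k, s̄]. -/

import Mathlib

open Filter

/- Example 2.13 of Roslanowski–Shelah.  H_N(n) = N.  An element of K_N is an FP
creature t = (nor[t], val[t], dis[t], m^t_dn, m^t_up) with dis[t] = (X_t, φ_t),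
X_t ⊊ [m^t_dn, m^t_up), φ_t : X_t → N, nor[t] = m^t_up, and val[t] determined as the
set of f : [m^t_dn, m^t_up) → N with φ_t ⊆ f which are constant on
[m^t_dn, m^t_up) ∖ X_t.  Partial finitary functions are modelled as g : ℕ → Option ℕ
with domain {j | (g j).isSome}; nor[t] and val[t] are determined by the remaining
data and are given by `CreatureN.mup` and `valN` below. -/
structure CreatureN (N : ℕ) where
  mdn : ℕ
  mup : ℕ
  hm : mdn < mup
  X : Finset ℕ
  hX : X ⊂ Finset.Ico mdn mup
  phi : ℕ → Option ℕ
  hdom : ∀ j, (phi j).isSome ↔ j ∈ X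
  hran : ∀ j a, phi j = some a → a < N

/- val[t] = {f : [m^t_dn, m^t_up) → N : φ_t ⊆ f and f constant on
[m^t_dn, m^t_up) ∖ X_t}. -/
def valN (N : ℕ) (t : CreatureN N) : Set (ℕ → Option ℕ) :=
  {f | (∀ j, (f j).isSome ↔ j ∈ Finset.Ico t.mdn t.mup) ∧
       (∀ j a, f j = some a → a < N) ∧
       (∀ j ∈ t.X, f j = t.phi j) ∧
       ∃ cst, ∀ j ∈ Finset.Ico t.mdn t.mup, j ∉ t.X → f j = some cst}

/- Σ_N(s_a, …, s_b): creatures t with the stated endpoints, ⋃_{a≤l≤b} X_{s_l} ⊆ X_t,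
and for each a ≤ l ≤ b either X_t ∩ [m^{s_l}_dn, m^{s_l}_up) = X_{s_l} and
φ_t↾[m^{s_l}_dn, m^{s_l}_up) = φ_{s_l}, or [m^{s_l}_dn, m^{s_l}_up) ⊊ X_t and
φ_t↾[m^{s_l}_dn, m^{s_l}_up) ∈ val[s_l]. -/
def SigmaN (N : ℕ) (s : ℕ → CreatureN N) (a b : ℕ) : Set (CreatureN N) :=
  {t | t.mdn = (s a).mdn ∧ t.mup = (s b).mup ∧
    (∀ l, a ≤ l → l ≤ b → (s l).X ⊆ t.X) ∧
    ∀ l, a ≤ l → l ≤ b →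
      ((t.X ∩ Finset.Ico (s l).mdn (s l).mup = (s l).X ∧
        ∀ j ∈ Finset.Ico (s l).mdn (s l).mup, t.phi j = (s l).phi j) ∨
       (Finset.Ico (s l).mdn (s l).mup ⊂ t.X ∧
        (fun j => if j ∈ Finset.Ico (s l).mdn (s l).mup then t.phi j else none)
          ∈ valN N (s l)))}

/- Tight pure candidates: m^{t_n}_up = m^{t_{n+1}}_dn and nor[t_n] = m^{t_n}_up → ∞. -/
def PCttN (N : ℕ) (t : ℕ → CreatureN N) : Prop :=
  (∀ n, (t n).mup = (t (n + 1)).mdn) ∧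
  Tendsto (fun n => (t n).mup) atTop atTop

/- t̄ ≤ s̄ iff there is a strictly increasing (j_n) with
t_n ∈ Σ_N(s_{j_n}, …, s_{j_{n+1}−1}) for all n. -/
def leN (N : ℕ) (t s : ℕ → CreatureN N) : Prop :=
  ∃ j : ℕ → ℕ, StrictMono j ∧ ∀ n, t n ∈ SigmaN N s (j n) (j (n + 1) - 1)

/- r_k(t̄) = (t_0, …, t_{k−1}). -/
def restrN (N : ℕ) (t : ℕ → CreatureN N) (k : ℕ) : List (CreatureN N) :=
  List.ofFn (fun i : Fin k => t i.1)

/- Σ_N(t̄) = ⋃_n Σ_N(t_0, …, t_n). -/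
def SigmaNtt (N : ℕ) (t : ℕ → CreatureN N) : Set (CreatureN N) :=
  ⋃ n, SigmaN N t 0 n

/- r_k[m, t̄] = {r_k(s̄) : s̄ ∈ [r_m(t̄), t̄]}, for t̄ ∈ PC^tt_∞(K_N, Σ_N). -/
def rsetN (N k m : ℕ) (t : ℕ → CreatureN N) : Set (List (CreatureN N)) :=
  {a | ∃ s : ℕ → CreatureN N, PCttN N s ∧ leN N s t ∧
    restrN N s m = restrN N t m ∧ a = restrN N s k}

attribute [local instance] Ultrafilter.mul Ultrafilter.semigroup

theorem aux_min_idem {M : Type*} [Nonempty M] [Semigroup M]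
    [TopologicalSpace M] [CompactSpace M] [T2Space M]
    (hcont : ∀ r : M, Continuous (· * r)) :
    ∃ p : M, p * p = p ∧ ∀ r : M, r * r = r → p * r = r → r * p = r → r = p := by
  let S : Set (Set M) :=
    { I | IsClosed I ∧ I.Nonempty ∧ ∀ m : M, ∀ m' ∈ I, m * m' ∈ I }
  have hz : ∃ I, Minimal (· ∈ S) I := by
    refine zorn_superset _ fun c hcs hc => ?_
    refine ⟨⋂₀ c, ⟨isClosed_sInter fun t ht => (hcs ht).1, ?_, fun m m' hm' => ?_⟩, fun s hs =>
      Set.sInter_subset_of_mem hs⟩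
    · obtain rfl | hcnemp := c.eq_empty_or_nonempty
      · rw [Set.sInter_empty]
        apply Set.univ_nonempty
      convert!
        @IsCompact.nonempty_iInter_of_directed_nonempty_isCompact_isClosed _ _ _ hcnemp.coe_sort
          ((↑) : c → Set M) ?_ ?_ ?_ ?_
      · exact Set.sInter_eq_iInter
      · refine DirectedOn.directed_val (IsChain.directedOn hc.symm)
      exacts [fun i => (hcs i.prop).2.1, fun i => (hcs i.prop).1.isCompact,
        fun i => (hcs i.prop).1]
    · rw [Set.mem_sInter]
      exact fun t ht => (hcs ht).2.2 m m' (Set.mem_sInter.mp hm' t ht)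
  obtain ⟨I, hI⟩ := hz
  obtain ⟨Icl, Ine, Imul⟩ := hI.prop
  obtain ⟨p, hp, hpp⟩ := exists_idempotent_in_compact_subsemigroup hcont I Ine Icl.isCompact
    (fun x _ y hy => Imul x y hy)
  refine ⟨p, hpp, fun r hr h1 h2 => ?_⟩
  have hrI : r ∈ I := h2 ▸ Imul r p hp
  have heq : Set.range (· * r) = I := by
    apply hI.eq_of_subset
    · refine ⟨(isCompact_range (hcont r)).isClosed, ⟨_, ⟨r, rfl⟩⟩, ?_⟩
      rintro m _ ⟨m', rfl⟩
      exact ⟨m * m', mul_assoc _ _ _⟩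
    · rintro _ ⟨m', rfl⟩
      exact Imul _ _ hrI
  rw [← heq] at hp
  obtain ⟨z, hz⟩ := hp
  have hz' : z * r = p := hz
  have : p * r = p := by rw [← hz', mul_assoc, hr]
  rw [← h1, this]

theorem aux_map_mul {M M' : Type*} [Mul M] [Mul M'] (f : M → M')
    (hf : ∀ x y, f (x * y) = f x * f y) (U V : Ultrafilter M) :
    (U * V).map f = U.map f * V.map f := by
  apply Ultrafilter.coe_inj.mp
  apply Filter.ext'
  intro P
  rw [Ultrafilter.eventually_mul]
  simp only [Ultrafilter.coe_map, Filter.eventually_map, Ultrafilter.eventually_mul, hf]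

def subW {N : ℕ} (e : Option (Fin N)) (x : List (Option (Fin N))) : List (Option (Fin N)) :=
  x.map (fun o => o.or e)

theorem aux_pq (N : ℕ) : ∃ q p : Ultrafilter (List (Option (Fin N))),
    (∀ᶠ x : List (Option (Fin N)) in (q : Filter (List (Option (Fin N)))), none ∈ x) ∧
    (∀ᶠ x : List (Option (Fin N)) in (p : Filter (List (Option (Fin N)))), none ∉ x) ∧
    (∀ P : List (Option (Fin N)) → Prop,
      ((∀ᶠ x in q, ∀ᶠ y in q, P (x ++ y)) ↔ ∀ᶠ x in q, P x) ∧
      ((∀ᶠ x in q, ∀ᶠ y in p, P (x ++ y)) ↔ ∀ᶠ x in q, P x) ∧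
      ((∀ᶠ x in p, ∀ᶠ y in q, P (x ++ y)) ↔ ∀ᶠ x in q, P x) ∧
      ((∀ᶠ x in p, ∀ᶠ y in p, P (x ++ y)) ↔ ∀ᶠ x in p, P x) ∧
      ∀ a : Fin N, (∀ᶠ x in q, P (subW (some a) x)) ↔ ∀ᶠ x in p, P x) := by
  classical
  obtain ⟨p0, hp0, hmin⟩ := aux_min_idem (M := Ultrafilter (FreeMonoid (Fin N)))
    Ultrafilter.continuous_mul_left
  let ι : FreeMonoid (Fin N) → FreeMonoid (Option (Fin N)) := fun x => List.map some x
  have hι : ∀ x y, ι (x * y) = ι x * ι y := fun x y => List.map_append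
  let σ : Fin N → FreeMonoid (Option (Fin N)) → FreeMonoid (Fin N) :=
    fun a x => List.map (fun o => o.getD a) x
  have hσ : ∀ a x y, σ a (x * y) = σ a x * σ a y := fun a x y => List.map_append
  have hσι : ∀ a, σ a ∘ ι = id := by
    intro a; funext x
    have h : ∀ y : List (Fin N), List.map (fun o : Option (Fin N) => o.getD a) (List.map some y) = y := by
      intro y; simp
    exact h x
  let p : Ultrafilter (FreeMonoid (Option (Fin N))) := p0.map ι
  have hp : p * p = p := by rw [← aux_map_mul ι hι, hp0]
  have hpσ : ∀ a, p.map (σ a) = p0 := by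
    intro a; rw [Ultrafilter.map_map, hσι, Ultrafilter.map_id]
  let V : Set (FreeMonoid (Option (Fin N))) := {x | none ∈ (show List (Option (Fin N)) from x)}
  have hVl : ∀ x y, x ∈ V → x * y ∈ V := fun x y h => List.mem_append_left _ h
  have hVr : ∀ x y, y ∈ V → x * y ∈ V := fun x y h => List.mem_append_right _ h
  have hVL : ∀ u v : Ultrafilter (FreeMonoid (Option (Fin N))), V ∈ u → V ∈ u * v := by
    intro u v hu
    change ∀ᶠ m in ↑(u * v), m ∈ V
    rw [Ultrafilter.eventually_mul]
    exact Filter.Eventually.mono hu fun x hx => Filter.Eventually.of_forall fun y => hVl x y hx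
  have hVR : ∀ u v : Ultrafilter (FreeMonoid (Option (Fin N))), V ∈ v → V ∈ u * v := by
    intro u v hu
    change ∀ᶠ m in ↑(u * v), m ∈ V
    rw [Ultrafilter.eventually_mul]
    exact Filter.Eventually.of_forall fun x => Filter.Eventually.mono hu fun y hy => hVr x y hy
  obtain ⟨q0, ⟨v, hv, hvq⟩, hq0⟩ := exists_idempotent_in_compact_subsemigroup
    (M := Ultrafilter (FreeMonoid (Option (Fin N)))) Ultrafilter.continuous_mul_left
    ((· * p) '' {u | V ∈ u})
    (by
      refine ⟨_, ⟨pure (FreeMonoid.of none), ?_, rfl⟩⟩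
      change FreeMonoid.of none ∈ V
      exact List.mem_singleton_self none)
    ((ultrafilter_isClosed_basic V).isCompact.image (Ultrafilter.continuous_mul_left p))
    (by
      rintro _ ⟨u, hu, rfl⟩ _ ⟨w, hw, rfl⟩
      refine ⟨u * p * w, ?_, ?_⟩
      · exact hVR (u * p) w hw
      · simp only [mul_assoc])
  have hq0p : q0 * p = q0 := by
    have hvq' : v * p = q0 := hvq
    rw [← hvq', mul_assoc, hp]
  have hVq0 : V ∈ q0 := by
    have hvq' : v * p = q0 := hvq
    rw [← hvq']; exact hVL _ _ hv
  let q := p * q0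
  have hqq : q * q = q := by
    change p * q0 * (p * q0) = p * q0
    rw [mul_assoc, ← mul_assoc q0 p, hq0p, hq0]
  have hpq : p * q = q := by
    change p * (p * q0) = p * q0
    rw [← mul_assoc, hp]
  have hqp : q * p = q := by
    change p * q0 * p = p * q0
    rw [mul_assoc, hq0p]
  have hVq : V ∈ q := hVR _ _ hVq0
  have hqσ : ∀ a, q.map (σ a) = p0 := by
    intro a
    apply hmin
    · rw [← aux_map_mul _ (hσ a), hqq]
    · conv_lhs => rw [← hpσ a]
      rw [← aux_map_mul _ (hσ a), hpq]
    · conv_lhs => rw [← hpσ a]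
      rw [← aux_map_mul _ (hσ a), hqp]
  have hsub : ∀ a, q.map (fun x => ι (σ a x)) = p := by
    intro a
    have := Ultrafilter.map_map q (σ a) ι
    rw [hqσ a] at this
    exact this.symm
  have key : ∀ u v w : Ultrafilter (FreeMonoid (Option (Fin N))), u * v = w →
      ∀ P : FreeMonoid (Option (Fin N)) → Prop,
      (∀ᶠ x in u, ∀ᶠ y in v, P (x * y)) ↔ ∀ᶠ x in w, P x := by
    rintro u v w rfl P
    exact (Ultrafilter.eventually_mul u v P).symm
  refine ⟨q, p, hVq, ?_, fun P => ⟨key q q q hqq P, key q p q hqp P, key p q q hpq P,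
    key p p p hp P, fun a => ?_⟩⟩
  · change ∀ᶠ x in Filter.map ι p0, _
    rw [Filter.eventually_map]
    refine Filter.Eventually.of_forall fun x => ?_
    have h : ∀ y : List (Fin N), none ∉ List.map some y := by
      intro y; simp
    exact h x
  · have hs : ∀ x : List (Option (Fin N)), subW (some a) x = ι (σ a x) := by
      intro x
      change _ = List.map _ (List.map _ x)
      rw [List.map_map]
      apply List.map_congr_left
      rintro (_ | o) _ <;> rfl
    conv_rhs => rw [← hsub a]
    exact Filter.eventually_congr (Filter.Eventually.of_forall fun x => by rw [hs x]; exact Iff.rfl)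

def redW {N : ℕ} (w : ℕ → List (Option (Fin N))) (e : ℕ → Option (Fin N)) (k : ℕ) :
    ℕ → List (Option (Fin N))
  | 0 => []
  | n + 1 => redW w e k n ++ subW (e (k + n)) (w (k + n))

def revL {α : Type*} (w : ℕ → α) : ℕ → List α
  | 0 => []
  | n + 1 => w n :: revL w n

def FW {N : ℕ} : List (List (Option (Fin N))) →
    Set (List (List (Option (Fin N))) × List (Option (Fin N)))
  | [] => {([], [])}
  | w :: R => insert (w :: R, [])
      ((fun z : (List (List (Option (Fin N))) × List (Option (Fin N))) × Option (Fin N) =>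
        (z.1.1, z.1.2 ++ subW z.2 w)) '' (FW R ×ˢ Set.univ))

theorem FW_fin {N : ℕ} (R : List (List (Option (Fin N)))) : (FW R).Finite := by
  induction R with
  | nil => exact Set.finite_singleton _
  | cons w R ih => exact ((ih.prod Set.finite_univ).image _).insert _

theorem FW_self {N : ℕ} (R : List (List (Option (Fin N)))) : (R, []) ∈ FW R := by
  cases R with
  | nil => exact Set.mem_singleton _
  | cons w R => exact Set.mem_insert _ _

theorem FW_red {N : ℕ} (w : ℕ → List (Option (Fin N))) (e : ℕ → Option (Fin N)) (k n : ℕ) :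
    (revL w k, redW w e k n) ∈ FW (revL w (k + n)) := by
  induction n with
  | zero => exact FW_self _
  | succ n ih => exact Set.mem_insert_of_mem _ ⟨((_, _), e (k + n)), ⟨ih, Set.mem_univ _⟩, rfl⟩

theorem word_thm {N : ℕ}
    (C : List (List (Option (Fin N))) → List (Option (Fin N)) → ℕ)
    (hC : ∀ R, ∃ b, ∀ x, C R x < b) :
    ∃ w : ℕ → List (Option (Fin N)), (∀ n, none ∈ w n) ∧
      ∀ k, ∃ ε, ∀ n e, none ∈ redW w e k n → C (revL w k) (redW w e k n) = ε := by
  classical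
  obtain ⟨q, p, hq, hp, hQ⟩ := aux_pq N
  have hcol : ∀ R, ∃ ε, ∀ᶠ x in q, C R x = ε := by
    intro R
    obtain ⟨b, hb⟩ := hC R
    have h1 : ∀ᶠ x in (q : Filter _), ∃ ε ∈ Set.Iio b, C R x = ε :=
      Filter.Eventually.of_forall fun x => ⟨_, hb x, rfl⟩
    obtain ⟨ε, _, h⟩ := (Ultrafilter.eventually_exists_mem_iff (Set.finite_Iio b)).1 h1
    exact ⟨ε, h⟩
  choose col hcol using hcol
  let G : List (List (Option (Fin N))) × List (Option (Fin N)) → Prop := fun z =>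
    (none ∈ z.2 → C z.1 z.2 = col z.1) ∧ (∀ᶠ y in q, C z.1 (z.2 ++ y) = col z.1) ∧
    (none ∈ z.2 → ∀ᶠ y in p, C z.1 (z.2 ++ y) = col z.1)
  have hstep : ∀ R x, G (R, x) → ∀ᶠ y in q, ∀ e, G (R, x ++ subW e y) := by
    rintro R x ⟨h1, h2, h3⟩
    simp only at h1 h2 h3
    rw [Filter.eventually_all]
    rintro (_ | a)
    · have hs : ∀ y : List (Option (Fin N)), subW none y = y := by
        intro y; simp [subW]
      simp only [hs]
      have h4 := ((hQ fun z => C R (x ++ z) = col R).1).2 h2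
      have h5 := ((hQ fun z => C R (x ++ z) = col R).2.1).2 h2
      filter_upwards [h2, h4, h5] with y hy2 hy4 hy5
      simp only [← List.append_assoc] at hy4 hy5
      exact ⟨fun _ => hy2, hy4, fun _ => hy5⟩
    · refine ((hQ fun y => G (R, x ++ y)).2.2.2.2 a).2 ?_
      have h4 := ((hQ fun z => C R (x ++ z) = col R).2.2.1).2 h2
      by_cases hx : none ∈ x
      · have h6 := h3 hx
        have h5 := ((hQ fun z => C R (x ++ z) = col R).2.2.2.1).2 h6
        filter_upwards [h6, h4, h5] with y hy2 hy4 hy5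
        simp only [← List.append_assoc] at hy4 hy5
        exact ⟨fun _ => hy2, hy4, fun _ => hy5⟩
      · filter_upwards [hp, h4] with y hy hy4
        simp only [← List.append_assoc] at hy4
        have : none ∉ x ++ y := by simp [hx, hy]
        exact ⟨fun h => absurd h this, hy4, fun h => absurd h this⟩
  have hself : ∀ R, G (R, []) := fun R =>
    ⟨fun h => by simp at h, by simpa using hcol R, fun h => by simp at h⟩
  have hext : ∀ R : {R : List (List (Option (Fin N))) // ∀ z ∈ FW R, G z},
      ∃ w, none ∈ w ∧ ∀ z ∈ FW (w :: R.1), G z := by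
    rintro ⟨R, hR⟩
    have h : ∀ᶠ y in (q : Filter _), ∀ z ∈ FW R, ∀ e, G (z.1, z.2 ++ subW e y) :=
      (Filter.eventually_all_finite (FW_fin R)).2 fun z hz => hstep z.1 z.2 (hR z hz)
    obtain ⟨w, hw1, hw2⟩ := (h.and hq).exists
    refine ⟨w, hw2, ?_⟩
    rintro z (rfl | ⟨⟨z, e⟩, ⟨hz, _⟩, rfl⟩)
    · exact hself _
    · exact hw1 z hz e
  choose nx hnx1 hnx2 using hext
  let st : ℕ → {R : List (List (Option (Fin N))) // ∀ z ∈ FW R, G z} := fun n =>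
    Nat.rec ⟨[], by
      intro z hz
      obtain rfl : z = ([], []) := hz
      exact hself _⟩ (fun _ R => ⟨nx R :: R.1, hnx2 R⟩) n
  let w : ℕ → List (Option (Fin N)) := fun n => nx (st n)
  have hst : ∀ n, (st n).1 = revL w n := by
    intro n
    induction n with
    | zero => rfl
    | succ n ih =>
      change nx (st n) :: (st n).1 = w n :: revL w n
      rw [ih]
  refine ⟨w, fun n => hnx1 _, fun k => ⟨col (revL w k), fun n e hn => ?_⟩⟩
  have := (st (k + n)).2 _ (by rw [hst]; exact FW_red w e k n)
  exact this.1 hn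

def Agr {N : ℕ} (t : ℕ → CreatureN N) (f : ℕ → Option ℕ) (i : ℕ)
    (x : List (Option (Fin N))) : Prop :=
  ∀ l (h : l < x.length), ∀ j ∈ Finset.Ico (t (i + l)).mdn (t (i + l)).mup,
    f j = ((t (i + l)).phi j).or ((x[l]).map Fin.val)

theorem Agr_append {N : ℕ} (t : ℕ → CreatureN N) (f : ℕ → Option ℕ) (i : ℕ)
    (x y : List (Option (Fin N))) (hx : Agr t f i x) (hy : Agr t f (i + x.length) y) :
    Agr t f i (x ++ y) := by
  intro l h j hj
  by_cases hl : l < x.length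
  · rw [List.getElem_append_left hl]
    exact hx l hl j hj
  · push Not at hl
    obtain ⟨d, rfl⟩ := Nat.exists_eq_add_of_le hl
    have hd : d < y.length := by
      rw [List.length_append] at h; omega
    have := hy d hd j (by rw [add_assoc]; exact hj)
    rw [add_assoc] at this
    rw [this, List.getElem_append_right hl]
    simp

theorem Agr_sub {N : ℕ} (t : ℕ → CreatureN N) (hm : StrictMono fun n => (t n).mdn)
    (ht : ∀ n, (t n).mup = (t (n + 1)).mdn) (f g : ℕ → Option ℕ) (i : ℕ)
    (x : List (Option (Fin N))) (e : Option (Fin N)) (hx : Agr t f i x)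
    (hg : ∀ j ∈ Finset.Ico (t i).mdn (t (i + x.length)).mdn, g j = (f j).or (e.map Fin.val)) :
    Agr t g i (subW e x) := by
  intro l h j hj
  have hl : l < x.length := by simpa [subW] using h
  have h1 : (t i).mdn ≤ (t (i + l)).mdn := hm.monotone (by omega)
  have h2 : (t (i + l)).mup ≤ (t (i + x.length)).mdn := by
    rw [ht]; exact hm.monotone (by omega)
  have hj' := Finset.mem_Ico.1 hj
  rw [hg j (Finset.mem_Ico.2 ⟨by omega, by omega⟩), hx l hl j hj, Option.or_assoc]
  congr 1
  simp only [subW, List.getElem_map]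
  cases x[l] <;> rfl

def Cr {N : ℕ} (t : ℕ → CreatureN N) (i : ℕ) (x : List (Option (Fin N)))
    (s : CreatureN N) : Prop :=
  s.mdn = (t i).mdn ∧ s.mup = (t (i + x.length)).mdn ∧ Agr t s.phi i x

theorem loc_ex {N : ℕ} (t : ℕ → CreatureN N)
    (ht : ∀ n, (t n).mup = (t (n + 1)).mdn) (i n j : ℕ)
    (hj : j ∈ Finset.Ico (t i).mdn (t (i + n)).mdn) :
    ∃ l < n, j ∈ Finset.Ico (t (i + l)).mdn (t (i + l)).mup := by
  induction n with
  | zero => simp at hj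
  | succ n ih =>
    rw [Finset.mem_Ico] at hj
    by_cases h : j < (t (i + n)).mdn
    · obtain ⟨l, hl, h'⟩ := ih (Finset.mem_Ico.2 ⟨hj.1, h⟩)
      exact ⟨l, by omega, h'⟩
    · refine ⟨n, by omega, Finset.mem_Ico.2 ⟨by omega, ?_⟩⟩
      rw [ht]; exact hj.2

theorem loc_un {N : ℕ} (t : ℕ → CreatureN N) (hm : StrictMono fun n => (t n).mdn)
    (ht : ∀ n, (t n).mup = (t (n + 1)).mdn) (a b j : ℕ)
    (ha : j ∈ Finset.Ico (t a).mdn (t a).mup) (hb : j ∈ Finset.Ico (t b).mdn (t b).mup) :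
    a = b := by
  rw [Finset.mem_Ico, ht] at ha hb
  rcases lt_trichotomy a b with h | h | h
  · have : (t (a + 1)).mdn ≤ (t b).mdn := hm.monotone h
    omega
  · exact h
  · have : (t (b + 1)).mdn ≤ (t a).mdn := hm.monotone h
    omega

theorem phi_out {N : ℕ} (s : CreatureN N) (j : ℕ) (hj : j ∉ Finset.Ico s.mdn s.mup) :
    s.phi j = none := by
  by_contra h
  have := (s.hdom j).1 (Option.isSome_iff_ne_none.2 h)
  exact hj (s.hX.1 this)

theorem creature_ext {N : ℕ} (s s' : CreatureN N) (h1 : s.mdn = s'.mdn) (h2 : s.mup = s'.mup)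
    (h3 : s.phi = s'.phi) : s = s' := by
  have h4 : s.X = s'.X := by
    ext j; rw [← s.hdom, ← s'.hdom, h3]
  cases s; cases s'
  simp only at h1 h2 h3 h4
  subst h1 h2 h3 h4
  rfl

theorem Cr_unique {N : ℕ} (t : ℕ → CreatureN N)
    (ht : ∀ n, (t n).mup = (t (n + 1)).mdn) (i : ℕ) (x : List (Option (Fin N)))
    (s s' : CreatureN N) (h : Cr t i x s) (h' : Cr t i x s') : s = s' := by
  obtain ⟨a1, a2, a3⟩ := h
  obtain ⟨b1, b2, b3⟩ := h'
  refine creature_ext s s' (a1.trans b1.symm) (a2.trans b2.symm) ?_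
  funext j
  by_cases hj : j ∈ Finset.Ico (t i).mdn (t (i + x.length)).mdn
  · obtain ⟨l, hl, hjl⟩ := loc_ex t ht i _ j hj
    rw [a3 l hl j hjl, b3 l hl j hjl]
  · rw [phi_out s j (by rwa [a1, a2]), phi_out s' j (by rwa [b1, b2])]

theorem Cr_none {N : ℕ} (t : ℕ → CreatureN N)
    (ht : ∀ n, (t n).mup = (t (n + 1)).mdn) (i : ℕ) (x : List (Option (Fin N)))
    (s : CreatureN N) (h : Cr t i x s) : none ∈ x := by
  obtain ⟨a1, a2, a3⟩ := h
  by_contra hx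
  apply s.hX.2
  intro j hj
  rw [a1, a2] at hj
  obtain ⟨l, hl, hjl⟩ := loc_ex t ht i _ j hj
  rw [← s.hdom, a3 l hl j hjl]
  cases hxl : x[l] with
  | none => exact absurd (hxl ▸ List.getElem_mem hl) hx
  | some a => simp

theorem Cr_exists {N : ℕ} (t : ℕ → CreatureN N) (hm : StrictMono fun n => (t n).mdn)
    (ht : ∀ n, (t n).mup = (t (n + 1)).mdn) (i : ℕ) (x : List (Option (Fin N)))
    (hx : none ∈ x) : ∃ s, Cr t i x s := by
  classical
  have hg : ∃ g : ℕ → ℕ, ∀ n, ∀ j ∈ Finset.Ico (t n).mdn (t n).mup, g j = n := by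
    refine ⟨fun j => if h : ∃ n, j ∈ Finset.Ico (t n).mdn (t n).mup then h.choose else 0, ?_⟩
    intro n j hj
    have h : ∃ n, j ∈ Finset.Ico (t n).mdn (t n).mup := ⟨n, hj⟩
    simp only [dif_pos h]
    exact loc_un t hm ht _ _ j h.choose_spec hj
  obtain ⟨g, hg⟩ := hg
  obtain ⟨l0, hl0, hxl0⟩ := List.getElem_of_mem hx
  let f : ℕ → Option ℕ := fun j =>
    if j ∈ Finset.Ico (t i).mdn (t (i + x.length)).mdn then
      ((t (g j)).phi j).or ((x.getD (g j - i) none).map Fin.val) else none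
  have hsubI : ∀ l < x.length, ∀ j ∈ Finset.Ico (t (i + l)).mdn (t (i + l)).mup,
      j ∈ Finset.Ico (t i).mdn (t (i + x.length)).mdn := by
    intro l hl j hj
    have h1 : (t i).mdn ≤ (t (i + l)).mdn := hm.monotone (by omega)
    have h2 : (t (i + l)).mup ≤ (t (i + x.length)).mdn := by
      rw [ht]; exact hm.monotone (by omega)
    have hj' := Finset.mem_Ico.1 hj
    exact Finset.mem_Ico.2 ⟨by omega, by omega⟩
  have hf : Agr t f i x := by
    intro l hl j hj
    simp only [f]
    rw [if_pos (hsubI l hl j hj), hg _ j hj]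
    congr 2
    simp [hl]
  obtain ⟨j0, hj0, hj0'⟩ := Finset.exists_of_ssubset (t (i + l0)).hX
  have hfj0 : f j0 = none := by
    rw [hf l0 hl0 j0 hj0, hxl0]
    have : (t (i + l0)).phi j0 = none := by
      by_contra h
      exact hj0' (((t (i + l0)).hdom j0).1 (Option.isSome_iff_ne_none.2 h))
    rw [this]; rfl
  refine ⟨⟨(t i).mdn, (t (i + x.length)).mdn, hm (by omega),
    (Finset.Ico (t i).mdn (t (i + x.length)).mdn).filter (fun j => (f j).isSome), ?_, f, ?_, ?_⟩,
    rfl, rfl, hf⟩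
  · rw [Finset.ssubset_iff_of_subset (Finset.filter_subset _ _)]
    exact ⟨j0, hsubI l0 hl0 j0 hj0, by simp [hfj0]⟩
  · intro j
    rw [Finset.mem_filter]
    refine ⟨fun h => ⟨?_, h⟩, fun h => h.2⟩
    by_contra h'
    simp only [f, if_neg h'] at h
    simp at h
  · intro j a hja
    simp only [f] at hja
    split_ifs at hja with h
    cases hp : (t (g j)).phi j with
    | some b =>
      rw [hp] at hja
      simp at hja
      exact hja ▸ (t (g j)).hran j b hp
    | none =>
      rw [hp] at hja
      simp only [Option.none_or, Option.map_eq_some_iff] at hja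
      obtain ⟨b, _, rfl⟩ := hja
      exact b.2

open Classical in
noncomputable def crf {N : ℕ} (t : ℕ → CreatureN N) (i : ℕ) (x : List (Option (Fin N))) :
    CreatureN N :=
  if h : ∃ s, Cr t i x s then h.choose else t 0

theorem crf_spec {N : ℕ} (t : ℕ → CreatureN N) (hm : StrictMono fun n => (t n).mdn)
    (ht : ∀ n, (t n).mup = (t (n + 1)).mdn) (i : ℕ) (x : List (Option (Fin N)))
    (hx : none ∈ x) : Cr t i x (crf t i x) := by
  have h := Cr_exists t hm ht i x hx
  rw [crf, dif_pos h]
  exact h.choose_spec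

def expW {N : ℕ} (z : Fin N) (x : List (Option (Fin N))) : List (Option (Fin N)) :=
  x.flatMap fun o => [o, some z, some z]

theorem expW_sub {N : ℕ} (z : Fin N) (e : Option (Fin N)) (x : List (Option (Fin N))) :
    subW e (expW z x) = expW z (subW e x) := by
  induction x with
  | nil => rfl
  | cons a x ih =>
    simp only [expW, subW, List.flatMap_cons, List.map_append, List.map_cons] at ih ⊢
    rw [ih]; rfl

theorem expW_red {N : ℕ} (z : Fin N) (w : ℕ → List (Option (Fin N))) (e : ℕ → Option (Fin N))
    (k n : ℕ) : redW (fun i => expW z (w i)) e k n = expW z (redW w e k n) := by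
  induction n with
  | zero => rfl
  | succ n ih =>
    simp only [redW, ih, expW_sub]
    simp only [expW, List.flatMap_append]

theorem expW_none {N : ℕ} (z : Fin N) (x : List (Option (Fin N))) :
    none ∈ expW z x ↔ none ∈ x := by
  simp [expW]

theorem expW_two {N : ℕ} (z : Fin N) (x : List (Option (Fin N))) (hx : none ∈ x) (l : ℕ) :
    ∃ l', ∃ h : l' < (expW z x).length, l' ≠ l ∧ (expW z x)[l'] = some z := by
  cases x with
  | nil => simp at hx
  | cons a x =>
    by_cases h : l = 1
    · exact ⟨2, by simp [expW], by omega, by simp [expW]⟩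
    · exact ⟨1, by simp [expW], by omega, by simp [expW]⟩

def totW {N : ℕ} (z : Fin N) : List (List (Option (Fin N))) → ℕ
  | [] => 0
  | w :: R => totW z R + (expW z w).length

noncomputable def crsW {N : ℕ} (t : ℕ → CreatureN N) (z : Fin N) :
    List (List (Option (Fin N))) → List (CreatureN N)
  | [] => []
  | w :: R => crsW t z R ++ [crf t (totW z R) (expW z w)]

theorem restrN_succ {N : ℕ} (s : ℕ → CreatureN N) (k : ℕ) :
    restrN N s (k + 1) = restrN N s k ++ [s k] := by
  unfold restrN
  rw [List.ofFn_succ_last]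
  rfl

theorem sigma_red {N : ℕ} (t : ℕ → CreatureN N) (hm : StrictMono fun n => (t n).mdn)
    (ht : ∀ n, (t n).mup = (t (n + 1)).mdn) (W : ℕ → List (Option (Fin N))) (m : ℕ → ℕ)
    (hmm : ∀ n, m (n + 1) = m n + (W n).length) (s : ℕ → CreatureN N)
    (hs : ∀ n, Cr t (m n) (W n) (s n)) (k b : ℕ) (hkb : k ≤ b) (x : CreatureN N)
    (hx : x ∈ SigmaN N s k b) : ∃ n e, Cr t (m k) (redW W e k n) x := by
  obtain ⟨h1, h2, h3, h4⟩ := hx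
  have he : ∀ l, ∃ e : Option (Fin N), k ≤ l → l ≤ b →
      ∀ j ∈ Finset.Ico (s l).mdn (s l).mup, x.phi j = ((s l).phi j).or (e.map Fin.val) := by
    intro l
    by_cases hl : k ≤ l ∧ l ≤ b
    · rcases h4 l hl.1 hl.2 with ⟨_, h⟩ | ⟨_, hv1, hv2, hv3, cst, hv4⟩
      · exact ⟨none, fun _ _ j hj => by simp [h j hj]⟩
      · obtain ⟨j0, hj0, hj0'⟩ := Finset.exists_of_ssubset (s l).hX
        have hc : cst < N := hv2 j0 cst (hv4 j0 hj0 hj0')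
        refine ⟨some ⟨cst, hc⟩, fun _ _ j hj => ?_⟩
        by_cases hjX : j ∈ (s l).X
        · have := hv3 j hjX
          simp only [if_pos hj] at this
          rw [this]
          have h5 := ((s l).hdom j).2 hjX
          obtain ⟨a, ha⟩ := Option.isSome_iff_exists.1 h5
          rw [ha]; rfl
        · have := hv4 j hj hjX
          simp only [if_pos hj] at this
          rw [this]
          have h5 : (s l).phi j = none := by
            by_contra h
            exact hjX (((s l).hdom j).1 (Option.isSome_iff_ne_none.2 h))
          rw [h5]; rfl
    · exact ⟨none, fun h h' => absurd ⟨h, h'⟩ hl⟩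
  choose e he using he
  have hind : ∀ n, n ≤ b + 1 - k →
      Agr t x.phi (m k) (redW W e k n) ∧ m k + (redW W e k n).length = m (k + n) := by
    intro n
    induction n with
    | zero => intro _; exact ⟨fun l h => by simp [redW] at h, by simp [redW]⟩
    | succ n ih =>
      intro hn
      obtain ⟨i1, i2⟩ := ih (by omega)
      obtain ⟨c1, c2, c3⟩ := hs (k + n)
      refine ⟨Agr_append _ _ _ _ _ i1 ?_, ?_⟩
      · rw [i2]
        refine Agr_sub t hm ht (s (k + n)).phi _ _ _ _ c3 ?_
        rw [← c1, ← c2]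
        exact he (k + n) (by omega) (by omega)
      · rw [redW, List.length_append, ← add_assoc, i2, ← add_assoc, hmm]
        simp [subW]
  obtain ⟨i1, i2⟩ := hind (b + 1 - k) le_rfl
  refine ⟨b + 1 - k, e, h1.trans (hs k).1, ?_, i1⟩
  rw [i2, h2, (hs b).2.1, ← hmm]
  rw [show k + (b + 1 - k) = b + 1 by omega]

theorem sigma_mem {N : ℕ} (t : ℕ → CreatureN N) (hm : StrictMono fun n => (t n).mdn)
    (ht : ∀ n, (t n).mup = (t (n + 1)).mdn) (x : List (Option (Fin N))) (z : Fin N) (i : ℕ)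
    (hx : none ∈ x) (s : CreatureN N) (hs : Cr t i (expW z x) s) :
    s ∈ SigmaN N t i (i + (expW z x).length - 1) := by
  obtain ⟨h1, h2, h3⟩ := hs
  have hpos : 0 < (expW z x).length := List.length_pos_of_mem ((expW_none z x).2 hx)
  have hsome : ∀ (l : ℕ) (h : l < (expW z x).length) (a : Fin N), (expW z x)[l] = some a →
      Finset.Ico (t (i + l)).mdn (t (i + l)).mup ⊆ s.X := by
    intro l h a ha j hj
    rw [← s.hdom, h3 l h j hj, ha]
    simp
  have hXs : ∀ l, l < (expW z x).length → (t (i + l)).X ⊆ s.X := by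
    intro l h j hj
    rw [← s.hdom, h3 l h j ((t (i + l)).hX.1 hj)]
    have := ((t (i + l)).hdom j).2 hj
    simp [this]
  refine ⟨h1, ?_, ?_, ?_⟩
  · rw [h2, ht]; congr 2; omega
  · intro l hl hl'
    obtain ⟨d, rfl⟩ := Nat.exists_eq_add_of_le hl
    exact hXs d (by omega)
  · intro l hl hl'
    obtain ⟨d, rfl⟩ := Nat.exists_eq_add_of_le hl
    have hd : d < (expW z x).length := by omega
    cases hxd : (expW z x)[d] with
    | none =>
      left
      have hphi : ∀ j ∈ Finset.Ico (t (i + d)).mdn (t (i + d)).mup,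
          s.phi j = (t (i + d)).phi j := by
        intro j hj
        rw [h3 d hd j hj, hxd]; simp
      refine ⟨?_, hphi⟩
      ext j
      rw [Finset.mem_inter]
      constructor
      · rintro ⟨ha, hb⟩
        rw [← (t (i + d)).hdom, ← hphi j hb, s.hdom]; exact ha
      · intro ha
        exact ⟨hXs d hd ha, (t (i + d)).hX.1 ha⟩
    | some a =>
      right
      have hsub := hsome d hd a hxd
      constructor
      · rw [Finset.ssubset_iff_of_subset hsub]
        obtain ⟨l', hl', hne, hz⟩ := expW_two z x hx d
        have hmem : (t (i + l')).mdn ∈ Finset.Ico (t (i + l')).mdn (t (i + l')).mup :=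
          Finset.mem_Ico.2 ⟨le_rfl, (t (i + l')).hm⟩
        refine ⟨(t (i + l')).mdn, hsome l' hl' z hz hmem, fun hc => hne ?_⟩
        have := loc_un t hm ht _ _ _ hmem hc
        omega
      · refine ⟨?_, ?_, ?_, a.val, ?_⟩
        · intro j
          by_cases hj : j ∈ Finset.Ico (t (i + d)).mdn (t (i + d)).mup
          · simp only [if_pos hj, hj, iff_true]
            exact (s.hdom j).2 (hsub hj)
          · simp only [if_neg hj, hj]; simp
        · intro j b hb
          simp only at hb
          split_ifs at hb with hj
          exact s.hran j b hb
        · intro j hj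
          have hj' := (t (i + d)).hX.1 hj
          simp only [if_pos hj']
          rw [h3 d hd j hj']
          obtain ⟨b, hb⟩ := Option.isSome_iff_exists.1 (((t (i + d)).hdom j).2 hj)
          rw [hb]; rfl
        · intro j hj hjX
          simp only [if_pos hj]
          rw [h3 d hd j hj, hxd]
          have h5 : (t (i + d)).phi j = none := by
            by_contra h
            exact hjX (((t (i + d)).hdom j).1 (Option.isSome_iff_ne_none.2 h))
          rw [h5]; rfl

/- STATEMENT 17 (Claim `d`, fusion):
Given t̄ ∈ PC^tt_∞(K_N, Σ_N) and colorings c_k : AR_{k+1}|t̄ → l_k with l_k ≥ 1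
(modelled as total colorings of finite approximations, i.e. lists of creatures, with
values < l_k), there is s̄ ≤ t̄ in PC^tt_∞(K_N, Σ_N) with m^{s_0}_dn = m^{t_0}_dn such
that c_0 is constant on r_1[0, s̄] ∩ Σ_N(s̄) (length-one approximations (x) being
identified with creatures x), and for each k ≥ 1, c_k is constant on r_{k+1}[k, s̄]. -/
theorem stmt17 (N : ℕ) (hN : 0 < N) (t : ℕ → CreatureN N) (ht : PCttN N t)
    (l : ℕ → ℕ) (hl : ∀ k, 1 ≤ l k)
    (c : ℕ → List (CreatureN N) → ℕ) (hc : ∀ k a, c k a < l k) :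
    ∃ s : ℕ → CreatureN N, PCttN N s ∧ leN N s t ∧ (s 0).mdn = (t 0).mdn ∧
      (∃ ε, ∀ x : CreatureN N,
        [x] ∈ rsetN N 1 0 s → x ∈ SigmaNtt N s → c 0 [x] = ε) ∧
      (∀ k, 1 ≤ k → ∃ ε, ∀ a ∈ rsetN N (k + 1) k s, c k a = ε) := by
  obtain ⟨ht, _⟩ := ht
  have hmono : ∀ u : ℕ → CreatureN N, (∀ n, (u n).mup = (u (n + 1)).mdn) →
      StrictMono fun n => (u n).mdn := fun u hu =>
    strictMono_nat_of_lt_succ fun n => by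
      have := (u n).hm
      rw [hu] at this; exact this
  have hm := hmono t ht
  let z : Fin N := ⟨0, hN⟩
  obtain ⟨w, hw, hcol⟩ := word_thm (N := N)
    (fun R x => c R.length (crsW t z R ++ [crf t (totW z R) (expW z x)]))
    (fun R => ⟨l R.length, fun x => hc _ _⟩)
  let m : ℕ → ℕ := fun n => totW z (revL w n)
  have hmm : ∀ n, m (n + 1) = m n + (expW z (w n)).length := fun n => rfl
  let s : ℕ → CreatureN N := fun n => crf t (m n) (expW z (w n))
  have hs : ∀ n, Cr t (m n) (expW z (w n)) (s n) := fun n =>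
    crf_spec t hm ht _ _ ((expW_none z _).2 (hw n))
  have hs1 : ∀ n, (s n).mup = (s (n + 1)).mdn := fun n => by
    rw [(hs n).2.1, (hs (n + 1)).1, hmm]
  have hsm := hmono s hs1
  have hrestr : ∀ k, restrN N s k = crsW t z (revL w k) := by
    intro k
    induction k with
    | zero => rfl
    | succ k ih => rw [restrN_succ, ih]; rfl
  have hlen : ∀ k, (revL w k).length = k := by
    intro k
    induction k with
    | zero => rfl
    | succ k ih => simp [revL, ih]
  have main : ∀ k, ∃ ε, ∀ b ≥ k, ∀ x ∈ SigmaN N s k b, c k (restrN N s k ++ [x]) = ε := by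
    intro k
    obtain ⟨ε, hε⟩ := hcol k
    refine ⟨ε, fun b hb x hx => ?_⟩
    obtain ⟨n, e, hcr⟩ := sigma_red t hm ht (fun n => expW z (w n)) m hmm s hs k b hb x hx
    rw [expW_red] at hcr
    have hnone := Cr_none t ht _ _ _ hcr
    have hxe : x = crf t (m k) (expW z (redW w e k n)) :=
      Cr_unique t ht _ _ _ _ hcr (crf_spec t hm ht _ _ hnone)
    have := hε n e ((expW_none z _).1 hnone)
    simp only [hlen] at this
    rw [hrestr, hxe]
    exact this
  refine ⟨s, ⟨hs1, ?_⟩, ⟨m, ?_, ?_⟩, (hs 0).1, ?_, ?_⟩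
  · have : (fun n => (s n).mup) = fun n => (s (n + 1)).mdn := funext hs1
    rw [this]
    exact (hsm.comp (strictMono_nat_of_lt_succ (f := fun n => n + 1)
      fun n => Nat.lt_succ_self _)).tendsto_atTop
  · refine strictMono_nat_of_lt_succ fun n => ?_
    have := List.length_pos_of_mem ((expW_none z _).2 (hw n))
    rw [hmm]; omega
  · intro n
    rw [hmm]
    exact sigma_mem t hm ht _ z _ (hw n) _ (hs n)
  · obtain ⟨ε, hε⟩ := main 0
    refine ⟨ε, fun x _ hx => ?_⟩
    obtain ⟨n, hn⟩ := Set.mem_iUnion.1 hx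
    exact hε n (Nat.zero_le _) x hn
  · intro k hk
    obtain ⟨ε, hε⟩ := main k
    refine ⟨ε, ?_⟩
    rintro a ⟨u, ⟨hu, _⟩, ⟨j, hj, hju⟩, hr, rfl⟩
    obtain ⟨k, rfl⟩ : ∃ k', k = k' + 1 := ⟨k - 1, by omega⟩
    have hlast : u k = s k := by
      rw [restrN_succ, restrN_succ] at hr
      have := (List.append_inj' hr rfl).2
      simpa using this
    have h1 : (s (j (k + 1))).mdn = (s (k + 1)).mdn := by
      rw [← (hju (k + 1)).1, ← hu, hlast, hs1]
    have h2 : j (k + 1) = k + 1 := hsm.injective h1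
    have h3 := hju (k + 1)
    rw [h2] at h3
    have h4 : j (k + 1) < j (k + 1 + 1) := hj (Nat.lt_succ_self _)
    rw [restrN_succ, hr]
    exact hε _ (by omega) _ h3
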